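/- There exists a locally integrable function φ : [0,1) → ℝ such that for every integer n ≥ 2 the supremum over all n-adic intervals J ⊆ [0,1) of ⨍_J |φ − ⨍_J φ| is finite, yet the supremum over all intervals I ⊆ [0,1) of positive length of ⨍_I |φ − ⨍_I φ| is infinite. In particular, ∩_{n≥2} BMO_n ⊊ BMO. -/

import Mathlib

open MeasureTheory Set
open scoped ENNReal

/-- The `n`-adic interval `[(k-1)/n^m, k/n^m)` (of length `n^{-m}`). -/
def nadicI (n : ℕ) (m k : ℤ) : Set ℝ :=
  Set.Ico ((k - 1 : ℝ) / (n : ℝ) ^ m) ((k : ℝ) / (n : ℝ) ^ m)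

/-- `J₁` and `J₂` are `n`-adic siblings: both are `n`-adic intervals of length
`n^{-(m+1)}` contained in a common `n`-adic interval of length `n^{-m}`. -/
def NAdicSiblings (n : ℕ) (J₁ J₂ : Set ℝ) : Prop :=
  ∃ m k₁ k₂ k : ℤ, J₁ = nadicI n (m + 1) k₁ ∧ J₂ = nadicI n (m + 1) k₂ ∧
    J₁ ⊆ nadicI n m k ∧ J₂ ⊆ nadicI n m k

/-- `I₁, I₂` are adjacent half-open intervals of equal positive length. -/
def AdjacentPair (I₁ I₂ : Set ℝ) : Prop :=
  ∃ x l : ℝ, 0 < l ∧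
    ((I₁ = Set.Ico (x - l) x ∧ I₂ = Set.Ico x (x + l)) ∨
     (I₂ = Set.Ico (x - l) x ∧ I₁ = Set.Ico x (x + l)))

/-- A one-sided logarithmic tent of height `L` and scale `σ`, starting at `x`. -/
noncomputable def logTent (x σ L t : ℝ) : ℝ :=
  if x < t then max 0 (L - |Real.log ((t - x) / σ)|) else 0

section LogTent

variable {x σ L : ℝ}

lemma measurable_logTent : Measurable (logTent x σ L) := by
  refine Measurable.ite measurableSet_Ioi ?_ measurable_const
  have h : Measurable fun t : ℝ => Real.log ((t - x) / σ) :=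
    Real.measurable_log.comp ((measurable_id.sub_const x).div_const σ)
  exact measurable_const.max (measurable_const.sub h.abs)

lemma logTent_nonneg (t : ℝ) : 0 ≤ logTent x σ L t := by
  unfold logTent
  split_ifs
  · exact le_max_left _ _
  · exact le_rfl

lemma logTent_le (hL : 0 ≤ L) (t : ℝ) : logTent x σ L t ≤ L := by
  unfold logTent
  split_ifs
  · exact max_le hL (by linarith [abs_nonneg (Real.log ((t - x) / σ))])
  · exact hL

lemma logTent_of_le {t : ℝ} (h : t ≤ x) : logTent x σ L t = 0 := if_neg h.not_gt

lemma logTent_eq_zero_of_small (hσ : 0 < σ) {t : ℝ} (h : t ≤ x + σ * Real.exp (-L)) :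
    logTent x σ L t = 0 := by
  unfold logTent
  split_ifs with hx
  · have h1 : Real.log ((t - x) / σ) ≤ -L := by
      rw [Real.log_le_iff_le_exp (div_pos (by linarith) hσ), div_le_iff₀ hσ]
      linarith
    exact max_eq_left (by linarith [neg_abs_le (Real.log ((t - x) / σ))])
  · rfl

lemma logTent_eq_zero_of_large (hσ : 0 < σ) {t : ℝ} (h : x + σ * Real.exp L ≤ t) :
    logTent x σ L t = 0 := by
  unfold logTent
  split_ifs with hx
  · have h1 : L ≤ Real.log ((t - x) / σ) := by
      rw [Real.le_log_iff_exp_le (div_pos (by linarith) hσ), le_div_iff₀ hσ]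
      linarith
    exact max_eq_left (by linarith [le_abs_self (Real.log ((t - x) / σ))])
  · rfl

lemma sub_one_le_logTent (hσ : 0 < σ) {t : ℝ} (h₁ : x + σ ≤ t) (h₂ : t ≤ x + 2 * σ) :
    L - 1 ≤ logTent x σ L t := by
  unfold logTent
  rw [if_pos (by linarith)]
  refine le_max_of_le_right ?_
  have h3 : 1 ≤ (t - x) / σ := by rw [le_div_iff₀ hσ]; linarith
  have h4 : (t - x) / σ ≤ 2 := by rw [div_le_iff₀ hσ]; linarith
  rw [abs_of_nonneg (Real.log_nonneg h3)]
  linarith [Real.log_le_sub_one_of_pos (show 0 < (t - x) / σ by linarith)]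

lemma abs_logTent_sub_le (hσ : 0 < σ) {s t : ℝ} (hs : x < s) (hst : s ≤ t) :
    |logTent x σ L s - logTent x σ L t| ≤ Real.log (t - x) - Real.log (s - x) := by
  unfold logTent
  rw [if_pos hs, if_pos (hs.trans_le hst), Real.log_div (by linarith) hσ.ne',
    Real.log_div (by linarith) hσ.ne']
  have h := Real.log_le_log (sub_pos.2 hs) (sub_le_sub_right hst x)
  calc _ ≤ abs ((L - |Real.log (s - x) - Real.log σ|) - (L - |Real.log (t - x) - Real.log σ|)) :=
        abs_max_sub_max_le_max _ _ _ _ |>.trans (by simp)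
    _ = abs (|Real.log (t - x) - Real.log σ| - |Real.log (s - x) - Real.log σ|) := by
        congr 1; ring
    _ ≤ |(Real.log (t - x) - Real.log σ) - (Real.log (s - x) - Real.log σ)| :=
        abs_abs_sub_abs_le_abs_sub _ _
    _ = _ := by rw [abs_of_nonneg] <;> linarith

lemma logTent_le_indicator (hσ : 0 < σ) (hL : 0 ≤ L) (t : ℝ) :
    logTent x σ L t ≤ (Ioc x (x + σ * Real.exp L)).indicator (fun _ => L) t := by
  by_cases h : t ∈ Ioc x (x + σ * Real.exp L)
  · rw [indicator_of_mem h]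
    exact logTent_le hL t
  · rw [indicator_of_notMem h]
    rw [mem_Ioc, not_and_or, not_lt, not_le] at h
    rcases h with h | h
    · exact (logTent_of_le h).le
    · exact (logTent_eq_zero_of_large hσ h.le).le

lemma integrable_indicator_Ioc_const (a b c : ℝ) :
    Integrable ((Ioc a b).indicator (fun _ => c)) :=
  (integrable_indicator_iff measurableSet_Ioc).2 (by simp)

lemma integrable_logTent (hσ : 0 < σ) (hL : 0 ≤ L) : Integrable (logTent x σ L) := by
  refine (integrable_indicator_Ioc_const x (x + σ * Real.exp L) L).mono'
    measurable_logTent.aestronglyMeasurable (.of_forall fun t => ?_)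
  rw [Real.norm_of_nonneg (logTent_nonneg t)]
  exact logTent_le_indicator hσ hL t

lemma integral_logTent_le (hσ : 0 < σ) (hL : 0 ≤ L) :
    ∫ t, logTent x σ L t ≤ L * (σ * Real.exp L) := by
  calc _ ≤ ∫ t, (Ioc x (x + σ * Real.exp L)).indicator (fun _ => L) t :=
        integral_mono (integrable_logTent hσ hL) (integrable_indicator_Ioc_const _ _ _)
          (logTent_le_indicator hσ hL)
    _ = _ := by
        rw [integral_indicator measurableSet_Ioc, setIntegral_const, Real.volume_real_Ioc_of_le
          (by have := Real.exp_pos L; nlinarith), smul_eq_mul]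
        ring

lemma intervalIntegrable_abs_logTent_sub (hσ : 0 < σ) (hL : 0 ≤ L) (a b c : ℝ) :
    IntervalIntegrable (fun t => |logTent x σ L t - c|) volume a b :=
  ((integrable_logTent hσ hL).intervalIntegrable.sub intervalIntegrable_const).abs

lemma integral_abs_logTent_sub_le (hσ : 0 < σ) (hL : 0 ≤ L) {a b : ℝ} (ha : x ≤ a) (hab : a < b) :
    ∫ t in a..b, |logTent x σ L t - logTent x σ L b| ≤ b - a := by
  have hint : IntervalIntegrable (fun t => Real.log (b - x) - Real.log (t - x)) volume a b := by
    have h := (intervalIntegral.intervalIntegrable_log' (a := a - x) (b := b - x)).comp_sub_right x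
    simp only [sub_add_cancel] at h
    exact intervalIntegrable_const.sub h
  calc _ ≤ ∫ t in a..b, (Real.log (b - x) - Real.log (t - x)) := by
        refine intervalIntegral.integral_mono_on_of_le_Ioo hab.le
          (intervalIntegrable_abs_logTent_sub hσ hL _ _ _) hint fun t ht => ?_
        exact abs_logTent_sub_le hσ (ha.trans_lt ht.1) ht.2.le
    _ = (b - a) - (a - x) * (Real.log (b - x) - Real.log (a - x)) := by
        rw [intervalIntegral.integral_comp_sub_right (fun s => Real.log (b - x) - Real.log s) x,
          intervalIntegral.integral_sub intervalIntegrable_const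
            intervalIntegral.intervalIntegrable_log', integral_log]
        simp only [intervalIntegral.integral_const, smul_eq_mul]
        ring
    _ ≤ b - a := by
        rcases ha.eq_or_lt with rfl | h
        · simp
        · have := Real.log_le_log (sub_pos.2 h) (sub_le_sub_right hab.le x)
          nlinarith

/-- A logarithmic tent has small mean oscillation over every interval that does not cut it
at its starting point, or cuts it only near an endpoint of the interval. -/
lemma exists_integral_abs_logTent_sub_le (hσ : 0 < σ) (hL : 1 ≤ L) {a b : ℝ} (hab : a < b)
    (h : a < x → x < b → σ * Real.exp (-L) < b - a → b - a < L * (σ * Real.exp L) →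
      L * (x - a) ≤ b - a ∨ L * (b - x) ≤ b - a) :
    ∃ c, ∫ t in a..b, |logTent x σ L t - c| ≤ 2 * (b - a) := by
  have hL0 : 0 ≤ L := by linarith
  have hI := intervalIntegrable_abs_logTent_sub (x := x) hσ hL0
  have hle : ∀ {a b c K : ℝ}, a ≤ b → (∀ t ∈ Ioo a b, |logTent x σ L t - c| ≤ K) →
      ∫ t in a..b, |logTent x σ L t - c| ≤ (b - a) * K := fun {a b c K} hab hK => by
    calc _ ≤ ∫ t in a..b, K :=
          intervalIntegral.integral_mono_on_of_le_Ioo hab (hI _ _ _) intervalIntegrable_const hK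
      _ = _ := by simp
  have habs : ∀ t, |logTent x σ L t - 0| = logTent x σ L t := fun t => by
    rw [sub_zero, abs_of_nonneg (logTent_nonneg t)]
  rcases le_or_gt b x with hbx | hbx
  · refine ⟨0, (hle (K := 0) hab.le fun t ht => ?_).trans (by linarith)⟩
    rw [habs, logTent_of_le (ht.2.le.trans hbx)]
  rcases le_or_gt x a with hax | hax
  · exact ⟨_, (integral_abs_logTent_sub_le hσ hL0 hax hab).trans (by linarith)⟩
  rcases le_or_gt (b - a) (σ * Real.exp (-L)) with hs | hs
  · refine ⟨0, (hle (K := 0) hab.le fun t ht => ?_).trans (by linarith)⟩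
    rw [habs, logTent_eq_zero_of_small hσ (by linarith [ht.2])]
  rcases le_or_gt (L * (σ * Real.exp L)) (b - a) with hl | hl
  · refine ⟨0, ?_⟩
    simp only [habs]
    rw [intervalIntegral.integral_of_le hab.le]
    have h1 := setIntegral_le_integral (s := Ioc a b) (integrable_logTent (x := x) hσ hL0)
      (.of_forall logTent_nonneg)
    have h2 := integral_logTent_le (x := x) hσ hL0
    linarith
  rcases h hax hbx hs hl with h | h
  · refine ⟨logTent x σ L b, ?_⟩
    rw [← intervalIntegral.integral_add_adjacent_intervals (hI a x _) (hI x b _)]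
    have h1 := integral_abs_logTent_sub_le (x := x) hσ hL0 le_rfl hbx
    have h2 := hle (c := logTent x σ L b) (K := L) hax.le fun t ht => by
      rw [logTent_of_le ht.2.le, zero_sub, abs_neg, abs_of_nonneg (logTent_nonneg b)]
      exact logTent_le hL0 b
    linarith
  · refine ⟨0, ?_⟩
    rw [← intervalIntegral.integral_add_adjacent_intervals (hI a x _) (hI x b _)]
    have h1 := hle (c := 0) (K := 0) hax.le fun t ht => by
      rw [habs, logTent_of_le ht.2.le]
    have h2 := hle (c := 0) (K := L) hbx.le fun t ht => by
      rw [habs]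
      exact logTent_le hL0 t
    linarith

lemma le_average_abs_logTent_sub (hσ : 0 < σ) (hL : 1 ≤ L) :
    (L - 1) / 4 ≤ ⨍ t in Ico (x - 2 * σ) (x + 2 * σ),
      |logTent x σ L t - ⨍ s in Ico (x - 2 * σ) (x + 2 * σ), logTent x σ L s| := by
  have hL0 : 0 ≤ L := by linarith
  set c := ⨍ s in Ico (x - 2 * σ) (x + 2 * σ), logTent x σ L s
  have hI := fun a b => intervalIntegrable_abs_logTent_sub (x := x) hσ hL0 a b c
  rw [setAverage_eq, Real.volume_real_Ico_of_le (by linarith), smul_eq_mul,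
    integral_Ico_eq_integral_Ioc, ← intervalIntegral.integral_of_le (by linarith),
    ← intervalIntegral.integral_add_adjacent_intervals (hI _ x) (hI x _),
    ← intervalIntegral.integral_add_adjacent_intervals (hI x (x + σ)) (hI _ _)]
  have h1 : 2 * σ * |c| ≤ ∫ t in (x - 2 * σ)..x, |logTent x σ L t - c| := by
    calc _ = ∫ t in (x - 2 * σ)..x, |c| := by simp
      _ ≤ _ := intervalIntegral.integral_mono_on_of_le_Ioo (by linarith)
        intervalIntegrable_const (hI _ _) fun t ht => by rw [logTent_of_le ht.2.le]; simp
  have h2 : 0 ≤ ∫ t in x..(x + σ), |logTent x σ L t - c| :=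
    intervalIntegral.integral_nonneg (by linarith) fun _ _ => abs_nonneg _
  have h3 : σ * (L - 1 - c) ≤ ∫ t in (x + σ)..(x + 2 * σ), |logTent x σ L t - c| := by
    calc _ = ∫ t in (x + σ)..(x + 2 * σ), (L - 1 - c) := by simp; ring
      _ ≤ _ := intervalIntegral.integral_mono_on_of_le_Ioo (by linarith)
        intervalIntegrable_const (hI _ _) fun t ht =>
          (sub_le_sub_right (sub_one_le_logTent hσ ht.1.le ht.2.le) c).trans (le_abs_self _)
  have h4 : σ * (L - 1) ≤ 2 * σ * |c| + σ * (L - 1 - c) := by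
    nlinarith [le_abs_self c, abs_nonneg c]
  rw [show x + 2 * σ - (x - 2 * σ) = 4 * σ by ring, inv_mul_eq_div, le_div_iff₀ (by positivity)]
  linarith

end LogTent

/-- **Dirichlet's simultaneous approximation theorem**, with a bound on the denominator. -/
lemma exists_nat_abs_mul_sub_int_le {ι : Type*} [Fintype ι] (M : ℕ) (hM : 0 < M) (a : ι → ℝ) :
    ∃ q : ℕ, 1 ≤ q ∧ q ≤ M ^ Fintype.card ι ∧ ∀ i, ∃ z : ℤ, |q * a i - z| ≤ 1 / M := by
  classical
  have hM' : (0 : ℝ) < M := by exact_mod_cast hM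
  let F : Fin (M ^ Fintype.card ι + 1) → ι → Fin M := fun q i =>
    ⟨⌊M * Int.fract ((q : ℕ) * a i)⌋₊, by
      rw [Nat.floor_lt (by have := Int.fract_nonneg ((q : ℕ) * a i); positivity)]
      nlinarith [Int.fract_lt_one ((q : ℕ) * a i)]⟩
  obtain ⟨q₁, q₂, hne, hF⟩ := Fintype.exists_ne_map_eq_of_card_lt F (by simp)
  wlog hlt : q₁ < q₂ generalizing q₁ q₂
  · exact this q₂ q₁ hne.symm hF.symm (lt_of_le_of_ne (not_lt.1 hlt) hne.symm)
  have hlt' : (q₁ : ℕ) < q₂ := hlt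
  refine ⟨q₂ - q₁, by omega, by omega, fun i =>
    ⟨⌊(q₂ : ℕ) * a i⌋ - ⌊(q₁ : ℕ) * a i⌋, ?_⟩⟩
  have hfl : ⌊M * Int.fract ((q₁ : ℕ) * a i)⌋₊ = ⌊M * Int.fract ((q₂ : ℕ) * a i)⌋₊ :=
    congrArg Fin.val (congrFun hF i)
  have n1 : 0 ≤ M * Int.fract ((q₁ : ℕ) * a i) := mul_nonneg hM'.le (Int.fract_nonneg _)
  have n2 : 0 ≤ M * Int.fract ((q₂ : ℕ) * a i) := mul_nonneg hM'.le (Int.fract_nonneg _)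
  have l1 := Nat.floor_le n1
  have l2 := Nat.floor_le n2
  have u1 := Nat.lt_floor_add_one (M * Int.fract ((q₁ : ℕ) * a i))
  have u2 := Nat.lt_floor_add_one (M * Int.fract ((q₂ : ℕ) * a i))
  rw [hfl] at l1 u1
  rw [Nat.cast_sub hlt'.le, le_div_iff₀ hM']
  have e : (((q₂ : ℕ) : ℝ) - (q₁ : ℕ)) * a i - ((⌊(q₂ : ℕ) * a i⌋ - ⌊(q₁ : ℕ) * a i⌋ : ℤ) : ℝ)
      = Int.fract ((q₂ : ℕ) * a i) - Int.fract ((q₁ : ℕ) * a i) := by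
    unfold Int.fract; push_cast; ring
  rw [e, ← abs_of_pos hM', ← abs_mul, abs_le]
  constructor <;> linarith

/-- For integers `n ≤ N`, the powers of `n` in a window of multiplicative width `W` starting
at `Y` simultaneously admit a number `q * s`, with `q` bounded independently of `Y` and `s`,
whose products with all these powers are close to integers. -/
lemma exists_nat_abs_zpow_mul_sub_int_le (N M : ℕ) (hM : 0 < M) {L W : ℝ} (hL : 0 < L)
    (hM' : L * (N * W) ≤ M) {Y : ℝ} (hY : 0 < Y) (s : ℝ) :
    ∃ q : ℕ, 1 ≤ q ∧ q ≤ M ^ (N + 1) ∧ ∀ n : ℕ, 2 ≤ n → n ≤ N → ∀ m : ℤ,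
      Y < (n : ℝ) ^ m → (n : ℝ) ^ m < Y * W → ∃ z : ℤ, |(n : ℝ) ^ m * (q * s) - z| ≤ 1 / L := by
  have hpow : ∀ n : ℕ, ∃ k : ℤ, 2 ≤ n → (n : ℝ) ^ k ≤ Y ∧ Y < (n : ℝ) ^ (k + 1) := fun n => by
    by_cases hn : 2 ≤ n
    · obtain ⟨k, hk⟩ := exists_mem_Ico_zpow hY (show (1 : ℝ) < n by exact_mod_cast hn)
      exact ⟨k, fun _ => hk⟩
    · exact ⟨0, fun h => absurd h hn⟩
  choose k hk using hpow
  obtain ⟨q, hq1, hq2, hq⟩ := exists_nat_abs_mul_sub_int_le M hM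
    fun i : Fin (N + 1) => ((i : ℕ) : ℝ) ^ k i * s
  rw [Fintype.card_fin] at hq2
  refine ⟨q, hq1, hq2, fun n hn hnN m hm1 hm2 => ?_⟩
  obtain ⟨z, hz⟩ := hq ⟨n, by omega⟩
  obtain ⟨hk1, hk2⟩ := hk n hn
  have hn1 : (1 : ℝ) < n := by exact_mod_cast hn
  have hn0 : (0 : ℝ) < n := by linarith
  have hkm : k n < m := (zpow_lt_zpow_iff_right₀ hn1).1 (hk1.trans_lt hm1)
  obtain ⟨i, hi⟩ := Int.eq_ofNat_of_zero_le (sub_nonneg.2 hkm.le)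
  have hm : (n : ℝ) ^ m = (n : ℝ) ^ i * (n : ℝ) ^ k n := by
    rw [← zpow_natCast, ← zpow_add₀ hn0.ne', show (i : ℤ) = m - k n from hi.symm, sub_add_cancel]
  have hkpos : (0 : ℝ) < (n : ℝ) ^ k n := zpow_pos hn0 _
  have hW : 0 < W := pos_of_mul_pos_right ((zpow_pos hn0 m).trans hm2) hY.le
  have hi' : (n : ℝ) ^ i ≤ N * W := by
    have h1 : (n : ℝ) ^ i * (n : ℝ) ^ k n < n * W * (n : ℝ) ^ k n := by
      rw [← hm]
      rw [zpow_add_one₀ hn0.ne'] at hk2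
      calc _ < Y * W := hm2
        _ ≤ (n : ℝ) ^ k n * n * W := by gcongr
        _ = _ := by ring
    have h2 : (n : ℝ) ≤ N := by exact_mod_cast hnN
    calc (n : ℝ) ^ i ≤ n * W := (lt_of_mul_lt_mul_right h1 hkpos.le).le
      _ ≤ N * W := by gcongr
  refine ⟨n ^ i * z, ?_⟩
  have hMpos : (0 : ℝ) < M := by exact_mod_cast hM
  calc |(n : ℝ) ^ m * (q * s) - ((n ^ i * z : ℤ) : ℝ)|
      = (n : ℝ) ^ i * |q * ((n : ℝ) ^ k n * s) - z| := by
        rw [← abs_of_pos (show (0 : ℝ) < (n : ℝ) ^ i by positivity), ← abs_mul, hm]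
        congr 1; push_cast; ring
    _ ≤ N * W * (1 / M) := by gcongr
    _ ≤ 1 / L := by
        rw [mul_one_div, div_le_div_iff₀ hMpos hL]
        linarith

lemma nadicI_eq_Ico (n : ℕ) (m k : ℤ) :
    nadicI n m k = Ico ((k - 1 : ℝ) / (n : ℝ) ^ m) ((k : ℝ) / (n : ℝ) ^ m) := rfl

/-- Building blocks: bounded functions supported in `[d, r)` with large mean oscillation, but
with uniformly bounded `n`-adic mean oscillation for all `n ≤ N`. -/
lemma exists_block (N : ℕ) {r : ℝ} (hr : 0 < r) :
    ∃ (f : ℝ → ℝ) (d : ℝ), 0 < d ∧ d < r ∧ Measurable f ∧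
      (∀ t, 0 ≤ f t ∧ f t ≤ 4 * N + 1) ∧ (∀ t, t ∉ Ico d r → f t = 0) ∧
      (∃ a b, d ≤ a ∧ a < b ∧ b ≤ r ∧ N ≤ ⨍ t in Ico a b, |f t - ⨍ s in Ico a b, f s|) ∧
      ∀ n : ℕ, 2 ≤ n → n ≤ N → ∀ m k : ℤ,
        ∃ c, ∫ t in nadicI n m k, |f t - c| ≤ 2 * ((n : ℝ) ^ m)⁻¹ := by
  obtain ⟨L, hLN⟩ : ∃ L : ℝ, L = 4 * N + 1 := ⟨_, rfl⟩
  have hL : 1 ≤ L := by rw [hLN]; linarith [N.cast_nonneg (α := ℝ)]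
  have hL0 : 0 < L := by linarith
  obtain ⟨E, hE⟩ : ∃ E : ℝ, E = Real.exp L := ⟨_, rfl⟩
  have hE2 : 2 ≤ E := by rw [hE]; linarith [Real.add_one_le_exp L]
  have hE0 : 0 < E := by linarith
  have hEinv : Real.exp (-L) = E⁻¹ := by rw [Real.exp_neg, hE]
  obtain ⟨M, hM⟩ := exists_nat_gt (L * (N * (L * E ^ 2)))
  have hM0 : 0 < M := by
    have : (0 : ℝ) < M := lt_of_le_of_lt (by positivity) hM
    exact_mod_cast this
  obtain ⟨K, hK⟩ : ∃ K : ℝ, K = 3 * (M : ℝ) ^ (N + 1) + E := ⟨_, rfl⟩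
  have hK0 : 0 < K := by rw [hK]; positivity
  obtain ⟨σ, hσr⟩ : ∃ σ : ℝ, σ = r / K := ⟨_, rfl⟩
  have hσ : 0 < σ := by rw [hσr]; positivity
  have hσK : σ * K = r := by rw [hσr]; field_simp
  obtain ⟨q, hq1, hq2, hq⟩ := exists_nat_abs_zpow_mul_sub_int_le N M hM0 hL0 hM.le
    (Y := (L * (σ * E))⁻¹) (by positivity) (3 * σ)
  obtain ⟨x, hx⟩ : ∃ x : ℝ, x = q * (3 * σ) := ⟨_, rfl⟩
  rw [← hx] at hq
  have hq1' : (1 : ℝ) ≤ q := by exact_mod_cast hq1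
  have hq2' : (q : ℝ) ≤ (M : ℝ) ^ (N + 1) := by exact_mod_cast hq2
  have hx3 : 3 * σ ≤ x := by rw [hx]; nlinarith
  have hxr : x + σ * E ≤ r := by
    rw [← hσK, hK, hx]
    nlinarith
  have hσE : σ * 2 ≤ σ * E := by gcongr
  refine ⟨logTent x σ L, x - 2 * σ, by linarith, by linarith, measurable_logTent,
    fun t => ⟨logTent_nonneg t, hLN ▸ logTent_le hL0.le t⟩, fun t ht => ?_,
    ⟨x - 2 * σ, x + 2 * σ, le_rfl, by linarith, by linarith,
      (by rw [hLN]; linarith : (N : ℝ) ≤ (L - 1) / 4).trans (le_average_abs_logTent_sub hσ hL)⟩,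
    fun n hn hnN m k => ?_⟩
  · rw [mem_Ico, not_and_or, not_le, not_lt] at ht
    rcases ht with ht | ht
    · exact logTent_of_le (by linarith)
    · exact logTent_eq_zero_of_large hσ (by rw [← hE]; linarith)
  · have hn0 : (0 : ℝ) < n := by exact_mod_cast (by omega : 0 < n)
    obtain ⟨A, hA⟩ : ∃ A : ℝ, A = (n : ℝ) ^ m := ⟨_, rfl⟩
    have hA0 : 0 < A := by rw [hA]; exact zpow_pos hn0 m
    have hlen : (k : ℝ) / A - (k - 1) / A = A⁻¹ := by field_simp; ring
    have hlt : ((k : ℝ) - 1) / A < k / A := by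
      have := inv_pos.2 hA0
      linarith
    obtain ⟨c, hc⟩ := exists_integral_abs_logTent_sub_le (x := x) hσ hL hlt fun h1 h2 h3 h4 => by
      rw [hlen, ← hE] at h4
      rw [hlen, hEinv] at h3
      rw [hlen]
      rw [div_lt_iff₀ hA0] at h1
      rw [lt_div_iff₀ hA0] at h2
      obtain ⟨z, hz⟩ := hq n hn hnN m
        (by rw [← hA]; exact (inv_lt_comm₀ hA0 (by positivity)).1 h4)
        (by
          rw [← hA]
          have h5 : A < (σ * E⁻¹)⁻¹ := (lt_inv_comm₀ (by positivity) hA0).1 h3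
          refine h5.trans_eq ?_
          field_simp)
      rw [← hA, le_div_iff₀ hL0] at hz
      rcases le_or_gt z (k - 1) with hzk | hzk
      · left
        have hzk' : (z : ℝ) ≤ k - 1 := by exact_mod_cast hzk
        have h5 : L * (A * x - (k - 1)) ≤ 1 := by nlinarith [le_abs_self (A * x - z)]
        calc L * (x - (k - 1) / A) = L * (A * x - (k - 1)) * A⁻¹ := by field_simp
          _ ≤ 1 * A⁻¹ := by gcongr
          _ = A⁻¹ := one_mul _
      · right
        have hzk' : (k : ℝ) ≤ z := by exact_mod_cast (by omega : k ≤ z)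
        have h5 : L * (k - A * x) ≤ 1 := by nlinarith [neg_abs_le (A * x - z)]
        calc L * (k / A - x) = L * (k - A * x) * A⁻¹ := by field_simp
          _ ≤ 1 * A⁻¹ := by gcongr
          _ = A⁻¹ := one_mul _
    refine ⟨c, ?_⟩
    rw [nadicI_eq_Ico, integral_Ico_eq_integral_Ioc, ← hA,
      ← intervalIntegral.integral_of_le hlt.le, ← hlen]
    exact hc

/-- A sequence of building blocks whose supports shrink rapidly to the origin. -/
lemma exists_block_seq :
    ∃ (f : ℕ → ℝ → ℝ) (d r : ℕ → ℝ), (∀ j, 0 < d j) ∧ (∀ j, d j < r j) ∧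
      (∀ j, r (j + 1) ≤ d j ^ 2 / 4) ∧ (∀ j, r j ≤ 1 / (4 * j + 1) ^ 2) ∧
      (∀ j, Measurable (f j)) ∧ (∀ j t, 0 ≤ f j t ∧ f j t ≤ 4 * j + 1) ∧
      (∀ j t, t ∉ Ico (d j) (r j) → f j t = 0) ∧
      (∀ j : ℕ, ∃ a b, d j ≤ a ∧ a < b ∧ b ≤ r j ∧
        j ≤ ⨍ t in Ico a b, |f j t - ⨍ s in Ico a b, f j s|) ∧
      ∀ j n : ℕ, 2 ≤ n → n ≤ j → ∀ m k : ℤ,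
        ∃ c, ∫ t in nadicI n m k, |f j t - c| ≤ 2 * ((n : ℝ) ^ m)⁻¹ := by
  choose! F D hF using fun (N : ℕ) (r : ℝ) (hr : 0 < r) => exists_block N hr
  let r : ℕ → ℝ := fun j =>
    Nat.rec 1 (fun i s => min (D i s ^ 2 / 4) (1 / (4 * ((i + 1 : ℕ) : ℝ) + 1) ^ 2)) j
  have hsucc : ∀ j, r (j + 1) =
      min (D j (r j) ^ 2 / 4) (1 / (4 * ((j + 1 : ℕ) : ℝ) + 1) ^ 2) := fun _ => rfl
  have hr : ∀ j, 0 < r j := fun j => by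
    induction j with
    | zero => exact one_pos
    | succ j ih =>
      rw [hsucc]
      have := (hF j _ ih).1
      exact lt_min (by positivity) (by positivity)
  refine ⟨fun j => F j (r j), fun j => D j (r j), r, fun j => (hF j _ (hr j)).1,
    fun j => (hF j _ (hr j)).2.1, fun j => (hsucc j).trans_le (min_le_left _ _), fun j => ?_,
    fun j => (hF j _ (hr j)).2.2.1, fun j => (hF j _ (hr j)).2.2.2.1,
    fun j => (hF j _ (hr j)).2.2.2.2.1, fun j => (hF j _ (hr j)).2.2.2.2.2.1,
    fun j => (hF j _ (hr j)).2.2.2.2.2.2⟩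
  cases j with
  | zero => simp [r]
  | succ j => exact (hsucc j).trans_le (min_le_right _ _)

/-- The mean oscillation is at most twice the mean distance to any constant. -/
lemma average_abs_sub_average_le {φ : ℝ → ℝ} {a b c K : ℝ} (hab : a < b)
    (hφ : IntegrableOn φ (Ico a b)) (h : ∫ t in Ico a b, |φ t - c| ≤ K * (b - a)) :
    ⨍ t in Ico a b, |φ t - ⨍ s in Ico a b, φ s| ≤ 2 * K := by
  have hba : 0 < b - a := sub_pos.2 hab
  have hvol : volume.real (Ico a b) = b - a := Real.volume_real_Ico_of_le hab.le
  have hconst : ∀ c : ℝ, IntegrableOn (fun _ => c) (Ico a b) := fun c => by simp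
  have hI : ∀ c, IntegrableOn (fun t => |φ t - c|) (Ico a b) := fun c => (hφ.sub (hconst c)).abs
  set A := ⨍ s in Ico a b, φ s with hA
  have hAint : (b - a) * A = ∫ s in Ico a b, φ s := by
    rw [hA, setAverage_eq, hvol, smul_eq_mul, mul_inv_cancel_left₀ hba.ne']
  have h1 : (b - a) * |c - A| ≤ ∫ t in Ico a b, |φ t - c| := by
    calc (b - a) * |c - A| = |∫ t in Ico a b, (φ t - c)| := by
          rw [integral_sub hφ (hconst c), setIntegral_const, hvol, smul_eq_mul, ← hAint, ← mul_sub,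
            abs_mul, abs_of_pos hba, abs_sub_comm]
      _ ≤ _ := abs_integral_le_integral_abs
  have h2 : ∫ t in Ico a b, |φ t - A| ≤ ∫ t in Ico a b, (|φ t - c| + |c - A|) :=
    integral_mono (hI A) ((hI c).add (hconst _)) fun t => abs_sub_le _ _ _
  rw [integral_add (hI c) (hconst _), setIntegral_const, hvol, smul_eq_mul] at h2
  rw [setAverage_eq, hvol, smul_eq_mul, inv_mul_le_iff₀ hba]
  linarith

lemma integrableOn_rpow_neg_half (s : ℝ) :
    IntegrableOn (fun t : ℝ => t ^ (-(1 / 2) : ℝ)) (Ico 0 s) := by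
  rcases le_or_gt s 0 with h | h
  · simp [Ico_eq_empty (not_lt.2 h)]
  · rw [integrableOn_Ico_iff_integrableOn_Ioo, ← integrableOn_Ioc_iff_integrableOn_Ioo,
      ← intervalIntegrable_iff_integrableOn_Ioc_of_le h.le]
    exact intervalIntegral.intervalIntegrable_rpow' (by norm_num)

lemma integral_rpow_neg_half {s : ℝ} (hs : 0 ≤ s) :
    ∫ t in Ico 0 s, t ^ (-(1 / 2) : ℝ) = 2 * √s := by
  rw [integral_Ico_eq_integral_Ioc, ← intervalIntegral.integral_of_le hs,
    integral_rpow (.inl (by norm_num)), Real.zero_rpow (by norm_num), Real.sqrt_eq_rpow]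
  norm_num
  ring

lemma le_rpow_neg_half {t K : ℝ} (hK : 0 < K) (ht : 0 < t) (h : t ≤ 1 / K ^ 2) :
    K ≤ t ^ (-(1 / 2) : ℝ) := by
  rw [Real.rpow_neg ht.le, ← Real.sqrt_eq_rpow, le_inv_comm₀ hK (Real.sqrt_pos.2 ht)]
  exact Real.sqrt_le_iff.2 ⟨by positivity, by rwa [inv_pow, ← one_div]⟩

/-- Theorem 1.3, part 3: `⋂_{n ≥ 2} BMO_n ⊊ BMO`. There is a locally
integrable function on `[0,1)` with bounded `n`-adic mean oscillation for every `n ≥ 2`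
but unbounded mean oscillation over arbitrary intervals. -/
theorem nadic_bmo_intersection_ne :
    ∃ φ : ℝ → ℝ, LocallyIntegrableOn φ (Set.Ico 0 1) ∧
      (∀ n : ℕ, 2 ≤ n → ∃ C : ℝ, ∀ m k : ℤ, nadicI n m k ⊆ Set.Ico 0 1 →
        (⨍ x in nadicI n m k, |φ x - ⨍ y in nadicI n m k, φ y|) ≤ C) ∧
      (∀ C : ℝ, ∃ x y : ℝ, 0 ≤ x ∧ x < y ∧ y ≤ 1 ∧
        C < ⨍ t in Set.Ico x y, |φ t - ⨍ s in Set.Ico x y, φ s|) := by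
  
  obtain ⟨f, d, r, hd, hdr, hrd, hrK, hfm, hfb, hfs, hosc, hnadic⟩ := exists_block_seq
  have hr : ∀ j, 0 < r j := fun j => (hd j).trans (hdr j)
  have hr1 : ∀ j, r j ≤ 1 := fun j => (hrK j).trans <| by
    rw [div_le_one (by positivity)]
    exact one_le_pow₀ (by linarith [j.cast_nonneg (α := ℝ)])
  have hrd' : ∀ j, r (j + 1) ≤ d j / 2 := fun j => by
    nlinarith [hrd j, hr1 j, hdr j, hd j]
  have hanti : Antitone r := antitone_nat_of_succ_le fun j => by
    linarith [hrd' j, hd j, hdr j]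
  have hdisj : ∀ {i j t}, t ∈ Ico (d i) (r i) → t ∈ Ico (d j) (r j) → i = j := by
    have key : ∀ {i j t}, i < j → t ∈ Ico (d i) (r i) → t ∉ Ico (d j) (r j) :=
      fun {i j t} hij hi hj => by
        have := hanti (Nat.succ_le_of_lt hij)
        have := hrd' i
        linarith [hi.1, hj.2, hd i]
    intro i j t hi hj
    rcases lt_trichotomy i j with h | h | h
    · exact absurd hj (key h hi)
    · exact h
    · exact absurd hi (key h hj)
  have hf0 : ∀ {i j t}, t ∈ Ico (d j) (r j) → i ≠ j → f i t = 0 := fun {i j t} hj hij =>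
    hfs i t fun hi => hij (hdisj hi hj)
  let φ : ℝ → ℝ := fun t => ∑' j, f j t
  have hφ : ∀ {j t}, t ∈ Ico (d j) (r j) → φ t = f j t := fun {j t} hj =>
    tsum_eq_single j fun i hij => hf0 hj hij
  have hφ0 : ∀ {t}, (∀ j, t ∉ Ico (d j) (r j)) → φ t = 0 := fun {t} h => by
    simp [φ, fun j => hfs j t (h j)]
  have hcases : ∀ t, (∃ j, t ∈ Ico (d j) (r j)) ∨ φ t = 0 := fun t => by
    by_cases h : ∃ j, t ∈ Ico (d j) (r j)
    · exact .inl h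
    · exact .inr (hφ0 (not_exists.1 h))
  have hφm : Measurable φ := by
    refine measurable_of_tendsto_metrizable
      (f := fun k t => ∑ j ∈ Finset.range k, f j t)
      (fun k => Finset.measurable_fun_sum _ fun j _ => hfm j) (tendsto_pi_nhds.2 fun t => ?_)
    refine (Summable.hasSum ?_).tendsto_sum_nat
    by_cases h : ∃ j, t ∈ Ico (d j) (r j)
    · obtain ⟨j, hj⟩ := h
      exact (hasSum_single j fun i hij => hf0 hj hij).summable
    · simp only [fun j => hfs j t (not_exists.1 h j)]
      exact summable_zero
  have hφb : ∀ {t}, 0 ≤ t → |φ t| ≤ t ^ (-(1 / 2) : ℝ) := fun {t} ht => by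
    rcases hcases t with ⟨j, hj⟩ | h
    · rw [hφ hj, abs_of_nonneg (hfb j t).1]
      exact (hfb j t).2.trans (le_rpow_neg_half (by positivity) ((hd j).trans_le hj.1)
        (hj.2.le.trans (hrK j)))
    · rw [h, abs_zero]
      exact Real.rpow_nonneg ht _
  have hφi : IntegrableOn φ (Ico 0 1) :=
    Integrable.mono' (integrableOn_rpow_neg_half 1) hφm.aestronglyMeasurable
      ((ae_restrict_iff' measurableSet_Ico).2 (.of_forall fun t ht => hφb ht.1))
  refine ⟨φ, hφi.locallyIntegrableOn, fun n hn => ⟨2 * (4 * n + 1 + 2 + 2), fun m k hJ => ?_⟩,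
    fun C => ?_⟩
  · have hn0 : (0 : ℝ) < n := by exact_mod_cast (by omega : 0 < n)
    have hA0 : 0 < (n : ℝ) ^ m := zpow_pos hn0 m
    have hlen : (k : ℝ) / (n : ℝ) ^ m - (k - 1) / (n : ℝ) ^ m = ((n : ℝ) ^ m)⁻¹ := by
      field_simp; ring
    have hnad := fun j hj => hnadic j n hn hj m k
    rw [← hlen] at hnad
    have hlt : ((k : ℝ) - 1) / (n : ℝ) ^ m < k / (n : ℝ) ^ m := by
      have := inv_pos.2 hA0
      linarith
    rw [nadicI_eq_Ico] at hJ hnad ⊢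
    generalize ((k : ℝ) - 1) / (n : ℝ) ^ m = a at *
    generalize (k : ℝ) / (n : ℝ) ^ m = b at *
    have ha : 0 ≤ a := (hJ ⟨le_rfl, hlt⟩).1
    have hba : 0 < b - a := sub_pos.2 hlt
    have hvol : volume.real (Ico a b) = b - a := Real.volume_real_Ico_of_le hlt.le
    have hφJ : IntegrableOn φ (Ico a b) := hφi.mono_set hJ
    have hconst : ∀ c : ℝ, IntegrableOn (fun _ => c) (Ico a b) := fun c => by simp
    have hlow : ∀ {i t}, i < n → f i t ≤ 4 * n + 1 := fun {i t} hi => by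
      have : (i : ℝ) ≤ n := by exact_mod_cast hi.le
      linarith [(hfb i t).2]
    suffices h : ∃ c, ∫ t in Ico a b, |φ t - c| ≤ (4 * n + 1 + 2 + 2) * (b - a) by
      obtain ⟨c, hc⟩ := h
      exact average_abs_sub_average_le hlt hφJ hc
    by_cases hex : ∃ j, n ≤ j ∧ (Ico a b ∩ Ico (d j) (r j)).Nonempty
    · classical
      obtain ⟨hnj, ⟨y, hyJ, hyj⟩⟩ := Nat.find_spec hex
      have hmin := fun i (hi : i < Nat.find hex) => Nat.find_min hex hi
      generalize Nat.find hex = j at *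
      obtain ⟨c, hc⟩ := hnad j hnj
      let s := r (j + 1)
      let ψ : ℝ → ℝ := (Ico 0 s).indicator fun t => t ^ (-(1 / 2) : ℝ)
      have hψ0 : ∀ t, 0 ≤ ψ t := fun t => indicator_nonneg (fun u hu => Real.rpow_nonneg hu.1 _) t
      have hψi : Integrable ψ :=
        (integrable_indicator_iff measurableSet_Ico).2 (integrableOn_rpow_neg_half s)
      have hψ : ∫ t in Ico a b, ψ t ≤ 2 * (b - a) := by
        rcases le_or_gt s a with hsa | hsa
        · rw [setIntegral_eq_zero_of_forall_eq_zero]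
          · linarith
          · exact fun t ht => indicator_of_notMem (fun h => by linarith [h.2, ht.1]) _
        · calc ∫ t in Ico a b, ψ t ≤ ∫ t, ψ t := setIntegral_le_integral hψi (.of_forall hψ0)
            _ = 2 * √s := by
              rw [integral_indicator measurableSet_Ico, integral_rpow_neg_half (hr _).le]
            _ ≤ 2 * (d j / 2) := by
              gcongr
              exact Real.sqrt_le_iff.2 ⟨(half_pos (hd j)).le, by linarith [hrd j]⟩
            _ ≤ 2 * (b - a) := by
              have := hrd' j
              linarith [hyJ.2, hyj.1]
      have hfi : IntegrableOn (fun t => |f j t - c|) (Ico a b) := by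
        refine ((Integrable.mono' (hconst (4 * j + 1)) (hfm j).aestronglyMeasurable
          (.of_forall fun t => ?_)).sub (hconst c)).abs
        rw [Real.norm_of_nonneg (hfb j t).1]
        exact (hfb j t).2
      refine ⟨c, ?_⟩
      have hpt : ∀ t ∈ Ico a b, |φ t - c| ≤ (4 * n + 1) + |f j t - c| + ψ t := fun t ht => by
        have h1 : (0 : ℝ) ≤ 4 * n + 1 := by positivity
        have htri : |φ t - c| ≤ |φ t - f j t| + |f j t - c| := abs_sub_le _ _ _
        suffices |φ t - f j t| ≤ (4 * n + 1) + ψ t by linarith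
        by_cases hij : ∃ i, t ∈ Ico (d i) (r i)
        · obtain ⟨i, hi⟩ := hij
          rcases lt_trichotomy i j with h | h | h
          · rw [hφ hi, hf0 hi h.ne', sub_zero, abs_of_nonneg (hfb i t).1]
            have hin : i < n := by
              by_contra hin
              exact hmin i h ⟨not_lt.1 hin, t, ht, hi⟩
            linarith [hlow (t := t) hin, hψ0 t]
          · rw [hφ hi, h, sub_self, abs_zero]
            linarith [hψ0 t]
          · rw [hf0 hi h.ne, sub_zero]
            have hts : t ∈ Ico 0 s := ⟨ha.trans ht.1, hi.2.trans_le (hanti h)⟩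
            have : ψ t = t ^ (-(1 / 2) : ℝ) := indicator_of_mem hts _
            linarith [hφb hts.1]
        · have := not_exists.1 hij
          rw [hφ0 this, hfs j t (this j), sub_zero, abs_zero]
          linarith [hψ0 t]
      calc ∫ t in Ico a b, |φ t - c| ≤ ∫ t in Ico a b, ((4 * n + 1) + |f j t - c| + ψ t) :=
            setIntegral_mono_on (hφJ.sub (hconst c)).abs
              (((hconst _).add hfi).add hψi.integrableOn) measurableSet_Ico hpt
        _ = (∫ t in Ico a b, (4 * n + 1 : ℝ)) + (∫ t in Ico a b, |f j t - c|)
            + ∫ t in Ico a b, ψ t := by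
            rw [← integral_add (hconst _) hfi]
            exact integral_add ((hconst _).add hfi) hψi.integrableOn
        _ ≤ _ := by
            rw [setIntegral_const, hvol, smul_eq_mul]
            linarith
    · refine ⟨0, ?_⟩
      calc ∫ t in Ico a b, |φ t - 0| ≤ ∫ t in Ico a b, (4 * n + 1 : ℝ) := by
            refine setIntegral_mono_on (hφJ.sub (hconst 0)).abs (hconst _) measurableSet_Ico
              fun t ht => ?_
            rw [sub_zero]
            rcases hcases t with ⟨i, hi⟩ | h
            · rw [hφ hi, abs_of_nonneg (hfb i t).1]
              refine hlow (not_le.1 fun hin => hex ⟨i, hin, t, ht, hi⟩)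
            · rw [h, abs_zero]
              positivity
        _ ≤ _ := by
            rw [setIntegral_const, hvol, smul_eq_mul]
            linarith
  · obtain ⟨j, hj⟩ := exists_nat_gt C
    obtain ⟨a, b, hda, hab, hbr, h⟩ := hosc j
    refine ⟨a, b, (hd j).le.trans hda, hab, hbr.trans (hr1 j),
      hj.trans_le (h.trans_eq ?_)⟩
    have heq : ∀ t ∈ Ico a b, f j t = φ t := fun t ht =>
      (hφ ⟨hda.trans ht.1, ht.2.trans_le hbr⟩).symm
    rw [setAverage_congr_fun measurableSet_Ico (.of_forall heq)]
    exact setAverage_congr_fun measurableSet_Ico (.of_forall fun t ht => by rw [heq t ht])
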